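/- (Theorem 1, Dis² bound.) Let ĥ, h̄, y*, y*_S, y*_T : X → Y be measurable classifiers with λ := ε_{μS}(y*, y*_S) + ε_{μT}(y*, y*_T), and suppose Δ(ĥ, y*) ≤ Δ(ĥ, h̄). Let nS, nT ≥ 1 and δ ∈ (0,1). Then with probability at least 1 − δ over i.i.d. samples xS : Fin nS → X from μS and xT : Fin nT → X from μT (joint law (Measure.pi fun _ : Fin nS => μS).prod (Measure.pi fun _ : Fin nT => μT)), it holds that ε_{μT}(ĥ, y*_T) ≤ ε̂_S(ĥ, y*_S) + Δ̂(ĥ, h̄) + sqrt((nS + 4·nT) · log(1/δ) / (2 · nS · nT)) + λ. -/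

import Mathlib

open MeasureTheory

/-- Population disagreement between two classifiers under measure `μ`. -/
noncomputable def err {X Y : Type*} [MeasurableSpace X] (μ : Measure X) (h h' : X → Y) : ℝ :=
  (μ {x | h x ≠ h' x}).toReal

/-- Disagreement discrepancy between target `μT` and source `μS`. -/
noncomputable def disc {X Y : Type*} [MeasurableSpace X] (μS μT : Measure X) (h h' : X → Y) : ℝ :=
  err μT h h' - err μS h h'

/-- Empirical disagreement between two classifiers on a finite sample. -/
noncomputable def empErr {X Y : Type*} [DecidableEq Y] {n : ℕ} (xs : Fin n → X)
    (h h' : X → Y) : ℝ :=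
  (1 / (n : ℝ)) * ∑ i, if h (xs i) ≠ h' (xs i) then 1 else 0

/-- Empirical disagreement discrepancy. -/
noncomputable def empDisc {X Y : Type*} [DecidableEq Y] {nS nT : ℕ}
    (xS : Fin nS → X) (xT : Fin nT → X) (h h' : X → Y) : ℝ :=
  empErr xT h h' - empErr xS h h'

theorem aux_ind_meas {X Y : Type*} [MeasurableSpace X] [MeasurableSpace Y]
    [MeasurableSingletonClass Y] [Fintype Y] [DecidableEq Y] {h h' : X → Y}
    (m : Measurable h) (m' : Measurable h') :
    Measurable (fun x => if h x ≠ h' x then (1 : ℝ) else 0) :=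
  Measurable.ite (measurableSet_eq_fun m m').compl measurable_const measurable_const

theorem aux_ind_integrable {X Y : Type*} [MeasurableSpace X] [MeasurableSpace Y]
    [MeasurableSingletonClass Y] [Fintype Y] [DecidableEq Y] {h h' : X → Y}
    (m : Measurable h) (m' : Measurable h') (μ : Measure X) [IsProbabilityMeasure μ] :
    Integrable (fun x => if h x ≠ h' x then (1 : ℝ) else 0) μ := by
  refine Integrable.of_mem_Icc 0 1 (aux_ind_meas m m').aemeasurable (Filter.Eventually.of_forall ?_)
  intro x
  split_ifs <;> simp

theorem aux_ind_int {X Y : Type*} [MeasurableSpace X] [MeasurableSpace Y]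
    [MeasurableSingletonClass Y] [Fintype Y] [DecidableEq Y] {h h' : X → Y}
    (m : Measurable h) (m' : Measurable h') (μ : Measure X) [IsProbabilityMeasure μ] :
    ∫ x, (if h x ≠ h' x then (1 : ℝ) else 0) ∂μ = err μ h h' := by
  have hs : MeasurableSet {x | h x ≠ h' x} := (measurableSet_eq_fun m m').compl
  have := integral_indicator_one (μ := μ) hs
  unfold err
  rw [← measureReal_def, ← this]
  congr 1
  ext x
  simp [Set.indicator_apply]

theorem aux_err_tri {X Y : Type*} [MeasurableSpace X]
    (μ : Measure X) [IsProbabilityMeasure μ] (a b c : X → Y) :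
    err μ a c ≤ err μ a b + err μ b c := by
  unfold err
  simp only [← measureReal_def]
  refine (measureReal_mono ?_).trans (measureReal_union_le _ _)
  intro x hx
  simp only [Set.mem_ofPred_eq, Set.mem_union] at *
  by_contra hh
  push Not at hh
  exact hx (hh.1.trans hh.2)

theorem aux_err_comm {X Y : Type*} [MeasurableSpace X]
    (μ : Measure X) (a b : X → Y) : err μ a b = err μ b a := by
  unfold err
  simp only [ne_comm]

theorem aux_subG {X : Type*} [MeasurableSpace X] (μ : Measure X) [IsProbabilityMeasure μ]
    (φ : X → ℝ) (hφ : Measurable φ) (a b : ℝ) (hb : ∀ x, φ x ∈ Set.Icc a b) (n : ℕ) (hn : 1 ≤ n) :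
    ∃ c : NNReal, (c : ℝ) = ((b - a) / 2) ^ 2 / n ∧
    ProbabilityTheory.HasSubgaussianMGF
      (fun x : Fin n → X => (∫ y, φ y ∂μ) - (1 / (n : ℝ)) * ∑ i, φ (x i)) c
      (Measure.pi fun _ : Fin n => μ) := by
  have h1 := (ProbabilityTheory.hasSubgaussianMGF_of_mem_Icc (μ := μ) hφ.aemeasurable
    (Filter.Eventually.of_forall hb))
  have hi : ∀ i : Fin n, ProbabilityTheory.HasSubgaussianMGF
      (fun x : Fin n → X => φ (x i) - ∫ y, φ y ∂μ) ((‖b - a‖₊ / 2) ^ 2)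
      (Measure.pi fun _ : Fin n => μ) := by
    intro i
    refine ProbabilityTheory.HasSubgaussianMGF.of_map (Y := fun x : Fin n → X => x i)
      (X := fun y => φ y - ∫ y, φ y ∂μ) (measurable_pi_apply i).aemeasurable ?_
    have := (measurePreserving_eval (fun _ : Fin n => μ) i).map_eq
    rw [show (fun x : Fin n → X => x i) = Function.eval i from rfl, this]
    exact h1
  have hind : ProbabilityTheory.iIndepFun
      (fun (i : Fin n) (x : Fin n → X) => φ (x i) - ∫ y, φ y ∂μ)
      (Measure.pi fun _ : Fin n => μ) :=
    ProbabilityTheory.iIndepFun_pi (X := fun _ y => φ y - ∫ y, φ y ∂μ)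
      (fun i => by fun_prop)
  have hs := (ProbabilityTheory.HasSubgaussianMGF.sum_of_iIndepFun hind (s := Finset.univ)
    (fun i _ => hi i)).const_mul (-(1 / (n : ℝ)))
  have hn0 : (n : ℝ) ≠ 0 := by positivity
  refine ⟨_, ?_, hs.congr (Filter.Eventually.of_forall ?_)⟩
  · simp only [Finset.sum_const, Finset.card_univ, Fintype.card_fin]
    have e : ((n • (‖b - a‖₊ / 2) ^ 2 : NNReal) : ℝ) = n * ((b - a) / 2) ^ 2 := by
      simp [div_pow]
    change (-(1 / (n : ℝ))) ^ 2 * ((n • (‖b - a‖₊ / 2) ^ 2 : NNReal) : ℝ) = _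
    rw [e]
    field_simp
  · intro x
    simp only [Finset.sum_sub_distrib, Finset.sum_const, Finset.card_univ, Fintype.card_fin,
      nsmul_eq_mul]
    field_simp
    ring

/-- Theorem 1 (Dis² bound): under the critic assumption `Δ(ĥ, y*) ≤ Δ(ĥ, h̄)`, with
probability at least `1 - δ` over i.i.d. samples,
`ε_{μT}(ĥ, y*_T) ≤ ε̂_S(ĥ, y*_S) + Δ̂(ĥ, h̄) + sqrt((nS + 4 nT) log(1/δ) / (2 nS nT)) + λ`. -/
theorem dis2_bound {X Y : Type*} [MeasurableSpace X] [MeasurableSpace Y]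
    [MeasurableSingletonClass Y] [Fintype Y] [Nonempty Y] [DecidableEq Y]
    (μS μT : Measure X) [IsProbabilityMeasure μS] [IsProbabilityMeasure μT]
    (hhat hbar ystar yS yT : X → Y)
    (mhat : Measurable hhat) (mbar : Measurable hbar) (mstar : Measurable ystar)
    (mS : Measurable yS) (mT : Measurable yT)
    (hcritic : disc μS μT hhat ystar ≤ disc μS μT hhat hbar)
    (nS nT : ℕ) (hnS : 1 ≤ nS) (hnT : 1 ≤ nT)
    (δ : ℝ) (hδ : δ ∈ Set.Ioo (0 : ℝ) 1) :
    ENNReal.ofReal (1 - δ) ≤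
      ((Measure.pi fun _ : Fin nS => μS).prod (Measure.pi fun _ : Fin nT => μT))
        {p : (Fin nS → X) × (Fin nT → X) |
          err μT hhat yT ≤
            empErr p.1 hhat yS + empDisc p.1 p.2 hhat hbar +
              Real.sqrt (((nS : ℝ) + 4 * (nT : ℝ)) * Real.log (1 / δ) /
                (2 * (nS : ℝ) * (nT : ℝ))) +
              (err μS ystar yS + err μT ystar yT)} := by
  obtain ⟨hδ0, hδ1⟩ := hδ
  have hnS0 : (0 : ℝ) < nS := by exact_mod_cast hnS
  have hnT0 : (0 : ℝ) < nT := by exact_mod_cast hnT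
  have hL : 0 < Real.log (1 / δ) := Real.log_pos (by rw [lt_div_iff₀ hδ0]; linarith)
  obtain ⟨cS, hcS, hS⟩ := aux_subG μS
    (fun x => (if hhat x ≠ yS x then (1 : ℝ) else 0) - (if hhat x ≠ hbar x then (1 : ℝ) else 0))
    ((aux_ind_meas mhat mS).sub (aux_ind_meas mhat mbar)) (-1) 1
    (by intro x; split_ifs <;> norm_num) nS hnS
  obtain ⟨cT, hcT, hT⟩ := aux_subG μT
    (fun x => (if hhat x ≠ hbar x then (1 : ℝ) else 0))
    (aux_ind_meas mhat mbar) 0 1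
    (by intro x; split_ifs <;> norm_num) nT hnT
  rw [integral_sub (aux_ind_integrable mhat mS μS) (aux_ind_integrable mhat mbar μS),
    aux_ind_int mhat mS, aux_ind_int mhat mbar] at hS
  rw [aux_ind_int mhat mbar] at hT
  set PS := (Measure.pi fun _ : Fin nS => μS)
  set PT := (Measure.pi fun _ : Fin nT => μT)
  have hind := ProbabilityTheory.indepFun_prod₀ (μ := PS) (ν := PT) hS.aemeasurable hT.aemeasurable
  have hS' := ProbabilityTheory.HasSubgaussianMGF.of_map (μ := PS.prod PT) (Y := Prod.fst)
    (by fun_prop) ((measurePreserving_fst (μ := PS) (ν := PT)).map_eq.symm ▸ hS)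
  have hT' := ProbabilityTheory.HasSubgaussianMGF.of_map (μ := PS.prod PT) (Y := Prod.snd)
    (by fun_prop) ((measurePreserving_snd (μ := PS) (ν := PT)).map_eq.symm ▸ hT)
  have hsum := hS'.add_of_indepFun hT' hind
  set ε := Real.sqrt (((nS : ℝ) + 4 * (nT : ℝ)) * Real.log (1 / δ) /
                (2 * (nS : ℝ) * (nT : ℝ))) with hε
  have hbd := hsum.measure_ge_le (ε := ε) (Real.sqrt_nonneg _)
  have hexp : Real.exp (-ε ^ 2 / (2 * ((cS + cT : NNReal) : ℝ))) = δ := by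
    rw [hε, Real.sq_sqrt (by positivity)]
    push_cast
    rw [hcS, hcT]
    have : -((nS + 4 * (nT : ℝ)) * Real.log (1 / δ) / (2 * nS * nT)) /
        (2 * (((1 - -1) / 2) ^ 2 / (nS : ℝ) + ((1 - 0) / 2) ^ 2 / (nT : ℝ))) = Real.log δ := by
      rw [one_div, Real.log_inv]
      field_simp
      ring
    rw [this, Real.exp_log hδ0]
  rw [hexp] at hbd
  set B := {ω : (Fin nS → X) × (Fin nT → X) | ε ≤ _} with hB
  have hB' : (PS.prod PT) B ≤ ENNReal.ofReal δ := by
    rw [← ofReal_measureReal (measure_ne_top _ _)]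
    exact ENNReal.ofReal_le_ofReal hbd
  rw [ENNReal.ofReal_sub _ hδ0.le, ENNReal.ofReal_one, tsub_le_iff_right]
  refine le_trans ?_ (add_le_add_right hB' _)
  rw [← measure_univ (μ := PS.prod PT)]
  refine (measure_mono ?_).trans (measure_union_le _ _)
  intro p _
  by_cases hp : p ∈ B
  · exact Or.inr hp
  left
  simp only [hB, Set.mem_ofPred_eq, Function.comp, not_le, Finset.sum_sub_distrib, mul_sub] at hp
  have t1 := aux_err_tri μT hhat ystar yT
  have t2 := aux_err_tri μS hhat yS ystar
  rw [aux_err_comm μS yS ystar] at t2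
  unfold disc at hcritic
  simp only [Set.mem_ofPred_eq, empDisc, empErr]
  linarith
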